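/- Let d ≥ 1 and p, q ∈ [0,1] with p ≥ √(2qd). Let u_0, …, u_{d−1}, v_0, …, v_{d−1} be i.i.d. Bernoulli(p) random variables and x_0, …, x_{d²−1} be i.i.d. Bernoulli(q) random variables, with all of these variables mutually independent. Then for every subset S ⊆ {0, …, d²−1}: P( Σ_{i∈S} u_{⌊i/d⌋} · v_{i mod d} = 0 ) ≤ P( Σ_{i∈S} x_i = 0 ). -/

import Mathlib

noncomputable section
open MeasureTheory

/-- The Bernoulli(p) measure on `ℝ`: mass `p` at `1` and mass `1 − p` at `0`. -/
def bern (p : ℝ) : Measure ℝ :=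
  ENNReal.ofReal p • Measure.dirac (1 : ℝ) + ENNReal.ofReal (1 - p) • Measure.dirac (0 : ℝ)

/-- The joint law of `d` i.i.d. Bernoulli(p) variables `u`, `d` i.i.d. Bernoulli(p)
variables `v`, and `d²` i.i.d. Bernoulli(q) variables `x`, all mutually independent. -/
def jointLaw (d : ℕ) (p q : ℝ) :
    Measure ((Fin d → ℝ) × (Fin d → ℝ) × (Fin (d * d) → ℝ)) :=
  (Measure.pi fun _ : Fin d => bern p).prod
    ((Measure.pi fun _ : Fin d => bern p).prod (Measure.pi fun _ : Fin (d * d) => bern q))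

lemma lintegral_bern (p : ℝ) (f : ℝ → ENNReal) :
    ∫⁻ y, f y ∂(bern p) = ENNReal.ofReal p * f 1 + ENNReal.ofReal (1 - p) * f 0 := by
  simp [bern]

lemma isProbabilityMeasure_bern {p : ℝ} (hp0 : 0 ≤ p) (hp1 : p ≤ 1) :
    IsProbabilityMeasure (bern p) := by
  constructor
  rw [← lintegral_one, lintegral_bern, mul_one, mul_one,
    ← ENNReal.ofReal_add hp0 (sub_nonneg.2 hp1)]
  simp

lemma ae_bern (p : ℝ) : ∀ᵐ y ∂(bern p), y = 0 ∨ y = 1 := by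
  rw [ae_iff, bern]
  simp

lemma bern_singleton_zero (p : ℝ) : bern p {0} = ENNReal.ofReal (1 - p) := by
  simp [bern]

section Pi

variable {ι : Type*} [Fintype ι]

lemma ae_pi_bern {p : ℝ} [IsProbabilityMeasure (bern p)] :
    ∀ᵐ y ∂(Measure.pi fun _ : ι => bern p), ∀ i, y i = 0 ∨ y i = 1 :=
  ae_all_iff.2 fun i =>
    (Measure.tendsto_eval_ae_ae (μ := fun _ : ι => bern p) (i := i)).eventually (ae_bern p)

lemma pi_bern_forall_mem_eq_zero {p : ℝ} [IsProbabilityMeasure (bern p)] (T : Finset ι) :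
    (Measure.pi fun _ : ι => bern p) {y | ∀ i ∈ T, y i = 0}
      = ENNReal.ofReal (1 - p) ^ T.card := by
  have h : {y : ι → ℝ | ∀ i ∈ T, y i = 0} = (T : Set ι).pi fun _ => {0} := by
    ext; simp [Set.mem_pi]
  rw [h, Measure.pi_pi_finset]
  simp [bern_singleton_zero]

lemma lintegral_pi_prod {α : ι → Type*} [∀ i, MeasurableSpace (α i)] (μ : ∀ i, Measure (α i))
    [∀ i, IsProbabilityMeasure (μ i)] {f : ∀ i, α i → ENNReal} (hf : ∀ i, Measurable (f i)) :
    ∫⁻ y, ∏ i, f i (y i) ∂(Measure.pi μ) = ∏ i, ∫⁻ x, f i x ∂(μ i) := by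
  refine (ProbabilityTheory.lintegral_prod_eq_prod_lintegral_of_indepFun Finset.univ
    (fun i (y : ∀ i, α i) => f i (y i))
    (ProbabilityTheory.iIndepFun_pi fun i => (hf i).aemeasurable)
    fun i => (hf i).comp (measurable_pi_apply i)).trans ?_
  exact Finset.prod_congr rfl fun i _ =>
    (measurePreserving_eval μ i).lintegral_comp (hf i)

end Pi

lemma ENNReal.le_prod_rpow_inv_card {ι : Type*} [Fintype ι] [Nonempty ι] {m : ENNReal}
    {b : ι → ENNReal} (h : ∀ i, m ≤ b i) : m ≤ ∏ i, b i ^ ((Fintype.card ι : ℝ)⁻¹) :=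
  calc m = ∏ _i : ι, m ^ ((Fintype.card ι : ℝ)⁻¹) := by
        rw [Finset.prod_const, Finset.card_univ, ENNReal.rpow_inv_natCast_pow]
        exact Fintype.card_ne_zero
    _ ≤ _ := Finset.prod_le_prod' fun i _ => ENNReal.rpow_le_rpow (h i) (by positivity)

/-- The contribution of one row with `s` entries. -/
lemma row_bound {d s : ℕ} {p q : ℝ} (hd : 0 < d) (hs : s ≤ d) (hp0 : 0 ≤ p) (hp1 : p ≤ 1)
    (hq1 : q ≤ 1) (hpq : q * d ≤ p ^ 2) :
    ENNReal.ofReal p * (ENNReal.ofReal (1 - p) ^ s) ^ ((d : ℝ)⁻¹) + ENNReal.ofReal (1 - p)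
      ≤ ENNReal.ofReal (1 - q) ^ s := by
  have hp : 0 ≤ 1 - p := sub_nonneg.2 hp1
  have hdR : (0 : ℝ) < d := Nat.cast_pos.2 hd
  have hrow : ((1 - p) ^ s) ^ ((d : ℝ)⁻¹) ≤ 1 - p * (s / d) := by
    have h := rpow_one_add_le_one_add_mul_self (s := -p) (by linarith)
      (p := s * (d : ℝ)⁻¹) (by positivity)
      (by rw [← div_eq_mul_inv]; exact div_le_one_of_le₀ (by exact_mod_cast hs) hdR.le)
    rw [← sub_eq_add_neg, Real.rpow_natCast_mul hp] at h
    rw [div_eq_mul_inv]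
    linarith
  have hbern := one_add_mul_le_pow (a := -q) (by linarith) s
  rw [← sub_eq_add_neg] at hbern
  have hqs : q * s ≤ p ^ 2 * (s / d) := by
    have := mul_le_mul_of_nonneg_right hpq (show (0 : ℝ) ≤ s / d by positivity)
    calc q * s = q * d * (s / d) := by field_simp
      _ ≤ _ := this
  rw [← ENNReal.ofReal_pow hp, ENNReal.ofReal_rpow_of_nonneg (by positivity) (by positivity),
    ← ENNReal.ofReal_mul hp0, ← ENNReal.ofReal_add (by positivity) hp,
    ← ENNReal.ofReal_pow (sub_nonneg.2 hq1)]
  apply ENNReal.ofReal_le_ofReal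
  nlinarith [mul_le_mul_of_nonneg_left hrow hp0]

/-- The columns of the entries of `S` that lie in row `i`. -/
def rowCols {d : ℕ} (S : Finset (Fin (d * d))) (i : Fin d) : Finset (Fin d) :=
  (S.filter fun k => k.divNat = i).image Fin.modNat

lemma sum_card_rowCols {d : ℕ} (S : Finset (Fin (d * d))) :
    ∑ i, (rowCols S i).card = S.card := by
  rw [Finset.card_eq_sum_card_fiberwise (f := Fin.divNat) (t := Finset.univ) (by simp)]
  refine Finset.sum_congr rfl fun i _ => Finset.card_image_of_injOn ?_
  intro a ha b hb hab
  simp only [Finset.coe_filter, Set.mem_ofPred_eq] at ha hb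
  exact finProdFinEquiv.symm.injective (Prod.ext (ha.2.trans hb.2.symm) hab)

lemma eq_zero_of_mem_rowCols {d : ℕ} {S : Finset (Fin (d * d))} {u v : Fin d → ℝ}
    (hu : ∀ i, u i = 0 ∨ u i = 1) (hv : ∀ j, v j = 0 ∨ v j = 1)
    (h : ∑ k ∈ S, u k.divNat * v k.modNat = 0) {i : Fin d} (hi : u i ≠ 0) :
    ∀ j ∈ rowCols S i, v j = 0 := by
  have hu0 (i) : 0 ≤ u i := by rcases hu i with h | h <;> simp [h]
  have hv0 (j) : 0 ≤ v j := by rcases hv j with h | h <;> simp [h]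
  rw [Finset.sum_eq_zero_iff_of_nonneg fun k _ => mul_nonneg (hu0 _) (hv0 _)] at h
  simp only [rowCols, Finset.mem_image, Finset.mem_filter]
  rintro _ ⟨k, ⟨hk, rfl⟩, rfl⟩
  exact (mul_eq_zero.1 (h k hk)).resolve_left hi

lemma jointLaw_products_le {d : ℕ} (hd : 1 ≤ d) {p q : ℝ} [IsProbabilityMeasure (bern p)]
    [IsProbabilityMeasure (bern q)] (S : Finset (Fin (d * d))) :
    jointLaw d p q {ω | ∑ k ∈ S, ω.1 k.divNat * ω.2.1 k.modNat = 0}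
      ≤ ∏ i : Fin d, (ENNReal.ofReal p *
          (ENNReal.ofReal (1 - p) ^ (rowCols S i).card) ^ ((d : ℝ)⁻¹)
            + ENNReal.ofReal (1 - p)) := by
  have : Nonempty (Fin d) := ⟨⟨0, hd⟩⟩
  let b (i : Fin d) (y : ℝ) : ENNReal :=
    if y = 0 then 1 else ENNReal.ofReal (1 - p) ^ (rowCols S i).card
  have hb (i) : Measurable (b i) :=
    Measurable.ite (measurableSet_singleton 0) measurable_const measurable_const
  have hmeas : MeasurableSet {ω : (Fin d → ℝ) × (Fin d → ℝ) × (Fin (d * d) → ℝ) |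
      ∑ k ∈ S, ω.1 k.divNat * ω.2.1 k.modNat = 0} :=
    measurableSet_eq_fun (by fun_prop) measurable_const
  rw [jointLaw, Measure.prod_apply hmeas]
  calc
    _ ≤ ∫⁻ u, ∏ i, b i (u i) ^ ((d : ℝ)⁻¹) ∂(Measure.pi fun _ : Fin d => bern p) := by
      refine lintegral_mono_ae ?_
      filter_upwards [ae_pi_bern] with u hu
      refine (ENNReal.le_prod_rpow_inv_card (b := fun i => b i (u i)) fun i => ?_).trans_eq
        (by rw [Fintype.card_fin])
      by_cases hi : u i = 0
      · simpa [b, hi] using prob_le_one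
      simp only [b, hi, if_false]
      calc
        _ ≤ ((Measure.pi fun _ : Fin d => bern p).prod
              (Measure.pi fun _ : Fin (d * d) => bern q))
              ({v | ∀ j ∈ rowCols S i, v j = 0} ×ˢ Set.univ) := by
          refine measure_mono_ae ?_
          filter_upwards [Measure.quasiMeasurePreserving_fst.ae ae_pi_bern] with vx hv h
          exact ⟨eq_zero_of_mem_rowCols hu hv h hi, trivial⟩
        _ = _ := by
          rw [Measure.prod_prod, pi_bern_forall_mem_eq_zero, measure_univ, mul_one]
    _ = _ := by
      rw [lintegral_pi_prod (fun _ : Fin d => bern p) fun i => (hb i).pow_const _]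
      simp [lintegral_bern, b]

lemma le_jointLaw_sum_eq_zero {d : ℕ} {p q : ℝ} [IsProbabilityMeasure (bern p)]
    [IsProbabilityMeasure (bern q)] (S : Finset (Fin (d * d))) :
    ENNReal.ofReal (1 - q) ^ S.card ≤ jointLaw d p q {ω | ∑ k ∈ S, ω.2.2 k = 0} := by
  calc
    _ = jointLaw d p q (Set.univ ×ˢ Set.univ ×ˢ {x | ∀ k ∈ S, x k = 0}) := by
      rw [jointLaw, Measure.prod_prod, Measure.prod_prod, pi_bern_forall_mem_eq_zero]
      simp
    _ ≤ _ := measure_mono fun ω hω => Finset.sum_eq_zero (by simpa using hω)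

/-- If `p ≥ √(2qd)`, then for every `S ⊆ {0, …, d²−1}`,
`P(∑_{i∈S} u_{⌊i/d⌋} v_{i mod d} = 0) ≤ P(∑_{i∈S} x_i = 0)`, where the `u`'s and `v`'s are
i.i.d. Bernoulli(p), the `x`'s are i.i.d. Bernoulli(q), and all are mutually independent. -/
theorem bernoulli_product_sum_vanishing_comparison (d : ℕ) (hd : 1 ≤ d) (p q : ℝ)
    (hq0 : 0 ≤ q) (hq1 : q ≤ 1) (hp1 : p ≤ 1)
    (hpq : Real.sqrt (2 * q * d) ≤ p) (S : Finset (Fin (d * d))) :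
    jointLaw d p q {ω | ∑ i ∈ S, ω.1 i.divNat * ω.2.1 i.modNat = 0}
      ≤ jointLaw d p q {ω | ∑ i ∈ S, ω.2.2 i = 0} := by
  have hp0 : 0 ≤ p := (Real.sqrt_nonneg _).trans hpq
  have hpq' : q * d ≤ p ^ 2 := by
    have := (Real.sqrt_le_left hp0).1 hpq
    have : 0 ≤ q * d := by positivity
    linarith
  have := isProbabilityMeasure_bern hp0 hp1
  have := isProbabilityMeasure_bern hq0 hq1
  calc
    _ ≤ _ := jointLaw_products_le hd S
    _ ≤ ∏ i : Fin d, ENNReal.ofReal (1 - q) ^ (rowCols S i).card :=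
      Finset.prod_le_prod' fun i _ => row_bound hd
        ((Finset.card_le_univ _).trans_eq (Fintype.card_fin d)) hp0 hp1 hq1 hpq'
    _ = ENNReal.ofReal (1 - q) ^ S.card := by
      rw [Finset.prod_pow_eq_pow_sum, sum_card_rowCols]
    _ ≤ _ := le_jointLaw_sum_eq_zero S
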